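/- Let T be a triangulation of the completed ∞-gon and let θ be a T-admissible sequence. Then the completed mutation μ̄_θ(T) of T along θ is a triangulation of the completed ∞-gon. -/

import Mathlib

open scoped Classical

/-- Vertices of the completed ∞-gon: `ℤ ∪ {−∞, +∞}` with the extended linear order. -/
abbrev Vtx : Type := WithBot (WithTop ℤ)

/-- The vertex corresponding to an integer. -/
def vInt (m : ℤ) : Vtx := ((m : WithTop ℤ) : Vtx)

/-- The vertex `+∞`. -/
def vTop : Vtx := ((⊤ : WithTop ℤ) : Vtx)

/-- The vertex `−∞`. -/
def vBot : Vtx := (⊥ : Vtx)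

/-- An arc of the completed ∞-gon: a pair of vertices `src < tgt` such that if both
endpoints are integers then they differ by at least `2`. -/
structure Arc where
  src : Vtx
  tgt : Vtx
  lt : src < tgt
  sep : ∀ m n : ℤ, src = vInt m → tgt = vInt n → m + 2 ≤ n

/-- Two arcs `(a,b)` and `(c,d)` cross if `a < c < b < d` or `c < a < d < b`. -/
def Cross (x y : Arc) : Prop :=
  (x.src < y.src ∧ y.src < x.tgt ∧ x.tgt < y.tgt) ∨
  (y.src < x.src ∧ x.src < y.tgt ∧ y.tgt < x.tgt)

/-- A triangulation of the completed ∞-gon: a maximal set of pairwise compatible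
(= non-crossing) arcs. -/
def IsTriangulation (T : Set Arc) : Prop :=
  (∀ x ∈ T, ∀ y ∈ T, ¬ Cross x y) ∧
  ∀ γ : Arc, (∀ x ∈ T, ¬ Cross γ x) → γ ∈ T

lemma vInt_lt_vTop (m : ℤ) : vInt m < vTop := by
  simpa [vInt, vTop] using WithBot.coe_lt_coe.mpr (WithTop.coe_lt_top (m : ℤ))

lemma vBot_lt_vInt (m : ℤ) : vBot < vInt m := WithBot.bot_lt_coe _

lemma vBot_lt_vTop : vBot < vTop := WithBot.bot_lt_coe _

lemma vTop_ne_vInt (n : ℤ) : vTop ≠ vInt n := by simp [vTop, vInt]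

lemma vBot_ne_vInt (n : ℤ) : vBot ≠ vInt n := by simp [vBot, vInt]

/-- The Prüfer curve `π_m = (m, +∞)`. -/
def prufer (m : ℤ) : Arc :=
  ⟨vInt m, vTop, vInt_lt_vTop m, fun _ n _ h => absurd h (vTop_ne_vInt n)⟩

/-- The adic curve `α_m = (−∞, m)`. -/
def adic (m : ℤ) : Arc :=
  ⟨vBot, vInt m, vBot_lt_vInt m, fun k _ h _ => absurd h (vBot_ne_vInt k)⟩

/-- The generic curve `z = (−∞, +∞)`. -/
def generic : Arc :=
  ⟨vBot, vTop, vBot_lt_vTop, fun k _ h _ => absurd h (vBot_ne_vInt k)⟩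

/-- `T` contains an arc with endpoints `x` and `y`. -/
def HasArc (T : Set Arc) (x y : Vtx) : Prop := ∃ γ ∈ T, γ.src = x ∧ γ.tgt = y

/-- `T` has a right fountain at the integer `n`. -/
def RightFountainInt (T : Set Arc) (n : ℤ) : Prop :=
  {p : ℤ | HasArc T (vInt n) (vInt p)}.Infinite

/-- `T` has a left fountain at the integer `n`. -/
def LeftFountainInt (T : Set Arc) (n : ℤ) : Prop :=
  {p : ℤ | HasArc T (vInt p) (vInt n)}.Infinite

/-- `T` has a right fountain at the vertex `v`. -/
def RightFountain (T : Set Arc) (v : Vtx) : Prop :=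
  (∃ n : ℤ, v = vInt n ∧ RightFountainInt T n) ∨
  (v = vTop ∧ {p : ℤ | 0 ≤ p ∧ prufer p ∈ T}.Infinite) ∨
  (v = vBot ∧ {p : ℤ | 0 ≤ p ∧ adic p ∈ T}.Infinite)

/-- `T` has a left fountain at the vertex `v`. -/
def LeftFountain (T : Set Arc) (v : Vtx) : Prop :=
  (∃ n : ℤ, v = vInt n ∧ LeftFountainInt T n) ∨
  (v = vTop ∧ {p : ℤ | p ≤ 0 ∧ prufer p ∈ T}.Infinite) ∨
  (v = vBot ∧ {p : ℤ | p ≤ 0 ∧ adic p ∈ T}.Infinite)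

/-- `T` is locally finite if every vertex is an endpoint of only finitely many arcs of `T`. -/
def LocallyFin (T : Set Arc) : Prop :=
  ∀ v : Vtx, {γ | γ ∈ T ∧ (γ.src = v ∨ γ.tgt = v)}.Finite

/-- An arc is peripheral if both endpoints are integers. -/
def IsPeripheral (γ : Arc) : Prop :=
  (∃ m : ℤ, γ.src = vInt m) ∧ ∃ n : ℤ, γ.tgt = vInt n

/-- `γ'` is an exchange partner for `γ` relative to `T`:
it is distinct from `γ` and `(T \ {γ}) ∪ {γ'}` is again a triangulation. -/
def MutExchange (T : Set Arc) (γ γ' : Arc) : Prop :=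
  γ' ≠ γ ∧ IsTriangulation ((T \ {γ}) ∪ {γ'})

/-- `γ` is a mutable arc of `T`. -/
def IsMutable (T : Set Arc) (γ : Arc) : Prop :=
  γ ∈ T ∧ ∃ γ', MutExchange T γ γ'

/-- The (unique) replacement arc of `γ` in `T`, when `γ` is mutable. -/
noncomputable def flipArc (T : Set Arc) (γ : Arc) : Arc :=
  if h : ∃ γ', MutExchange T γ γ' then h.choose else γ

/-- The mutation `μ_γ(T)` of `T` at `γ`. -/
noncomputable def mutate (T : Set Arc) (γ : Arc) : Set Arc :=
  (T \ {γ}) ∪ {flipArc T γ}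

/-- `μ_γ(δ)`: the effect of the mutation of `T` at `γ` on the arc `δ`. -/
noncomputable def mutArc (T : Set Arc) (γ δ : Arc) : Arc :=
  if δ = γ then flipArc T γ else δ

/-- One step of a mutation sequence on a set of arcs (`none` = no entry). -/
noncomputable def stepT (T : Set Arc) : Option Arc → Set Arc
  | none => T
  | some γ => mutate T γ

/-- One step of a mutation sequence on a single arc. -/
noncomputable def stepA (T : Set Arc) : Option Arc → Arc → Arc
  | none, δ => δ
  | some γ, δ => mutArc T γ δ

/-- `iterT T θ k` is `μ_{θ_k} ∘ ⋯ ∘ μ_{θ_1}(T)`. Sequences (finite or infinite) are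
encoded as `θ : ℕ → Option Arc` whose support is downward closed. -/
noncomputable def iterT (T : Set Arc) (θ : ℕ → Option Arc) : ℕ → Set Arc
  | 0 => T
  | k + 1 => stepT (iterT T θ k) (θ k)

/-- `iterA T θ γ k` is `μ_{θ_k} ∘ ⋯ ∘ μ_{θ_1}(γ)`. -/
noncomputable def iterA (T : Set Arc) (θ : ℕ → Option Arc) (γ : Arc) : ℕ → Arc
  | 0 => γ
  | k + 1 => stepA (iterT T θ k) (θ k) (iterA T θ γ k)

/-- `θ` is a `T`-admissible sequence: its support is downward closed (so it is a genuine
finite or infinite sequence), each entry is mutable in the triangulation obtained by the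
previous mutations, and the mutation of each arc of `T` along `θ` eventually stabilizes. -/
def Admissible (T : Set Arc) (θ : ℕ → Option Arc) : Prop :=
  (∀ i, θ i = none → θ (i + 1) = none) ∧
  (∀ i γ, θ i = some γ → IsMutable (iterT T θ i) γ) ∧
  (∀ γ ∈ T, ∃ l, ∀ k, l ≤ k → iterA T θ γ k = iterA T θ γ l)

/-- `μ_θ(γ)`: the stable value of the mutation of the arc `γ` along the sequence `θ`. -/
noncomputable def seqLimit (T : Set Arc) (θ : ℕ → Option Arc) (γ : Arc) : Arc :=
  if h : ∃ l, ∀ k, l ≤ k → iterA T θ γ k = iterA T θ γ l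
  then iterA T θ γ h.choose else γ

/-- `μ_θ(T)`: the mutation of `T` along the sequence `θ`. -/
noncomputable def mutSeq (T : Set Arc) (θ : ℕ → Option Arc) : Set Arc :=
  seqLimit T θ '' T

/-- The sequence `θ` leaves the arc `γ` untouched. -/
def Untouched (T : Set Arc) (θ : ℕ → Option Arc) (γ : Arc) : Prop :=
  ∀ l, iterA T θ γ l = γ

/-- The quadrilateral `S(γ)` of a mutable arc `γ` in `T`: with `v₁ < v₂ < v₃ < v₄` the four
endpoints of the two diagonals `γ` and `flipArc T γ`, it consists of those of the pairs
`(v₁,v₂), (v₂,v₃), (v₃,v₄), (v₁,v₄)` that are arcs. -/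
noncomputable def quad (T : Set Arc) (γ : Arc) : Set Arc :=
  let γ' := flipArc T γ
  let vs : Vtx × Vtx × Vtx × Vtx :=
    if γ.src < γ'.src then (γ.src, γ'.src, γ.tgt, γ'.tgt) else (γ'.src, γ.src, γ'.tgt, γ.tgt)
  {δ : Arc | (δ.src = vs.1 ∧ δ.tgt = vs.2.1) ∨ (δ.src = vs.2.1 ∧ δ.tgt = vs.2.2.1) ∨
    (δ.src = vs.2.2.1 ∧ δ.tgt = vs.2.2.2) ∨ (δ.src = vs.1 ∧ δ.tgt = vs.2.2.2)}

/-- The set `𝒫` of Prüfer curves compatible with every arc of `S`. -/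
def pruferCompletion (S : Set Arc) : Set Arc :=
  {γ | (∃ k : ℤ, γ = prufer k) ∧ ∀ x ∈ S, ¬ Cross γ x}

/-- The set `𝒜̃` of adic curves compatible with every arc of `S ∪ 𝒫(S)`. -/
def adicCompletion' (S : Set Arc) : Set Arc :=
  {γ | (∃ k : ℤ, γ = adic k) ∧ ∀ x ∈ S ∪ pruferCompletion S, ¬ Cross γ x}

/-- The completed (Prüfer) mutation `μ̄_θ(T) = μ_θ(T) ∪ 𝒫 ∪ 𝒜̃` of `T` along `θ`. -/
noncomputable def completedMut (T : Set Arc) (θ : ℕ → Option Arc) : Set Arc :=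
  mutSeq T θ ∪ pruferCompletion (mutSeq T θ) ∪ adicCompletion' (mutSeq T θ)

/-- The tower of triangulations associated to a composition of completed mutations. -/
noncomputable def compIter (T : Set Arc) (Θ : ℕ → Option (ℕ → Option Arc)) : ℕ → Set Arc
  | 0 => T
  | k + 1 =>
    match Θ k with
    | none => compIter T Θ k
    | some θ => completedMut (compIter T Θ k) θ

/-- `Θ` is a `T`-admissible composition of completed mutations. -/
def CompAdmissible (T : Set Arc) (Θ : ℕ → Option (ℕ → Option Arc)) : Prop :=
  (∀ i, Θ i = none → Θ (i + 1) = none) ∧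
  ∀ i θ, Θ i = some θ → Admissible (compIter T Θ i) θ

/-- The transfinite mutation of `T` along the composition `Θ`. -/
noncomputable def transfiniteMut (T : Set Arc) (Θ : ℕ → Option (ℕ → Option Arc)) : Set Arc :=
  ⋃ i, {γ ∈ compIter T Θ i |
    ∀ k, i ≤ k → ∀ θ, Θ k = some θ → Untouched (compIter T Θ k) θ γ}

theorem vInt_lt_iff (a b : ℤ) : vInt a < vInt b ↔ a < b := by
  simp [vInt]

theorem vInt_le_iff (a b : ℤ) : vInt a ≤ vInt b ↔ a ≤ b := by
  simp [vInt]

theorem vtx_cases (v : Vtx) : v = vBot ∨ v = vTop ∨ ∃ m : ℤ, v = vInt m := by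
  induction v using WithBot.recBotCoe with
  | bot => exact Or.inl rfl
  | coe a =>
    induction a using WithTop.recTopCoe with
    | top => exact Or.inr (Or.inl rfl)
    | coe m => exact Or.inr (Or.inr ⟨m, rfl⟩)

theorem vBot_le (v : Vtx) : vBot ≤ v := bot_le

theorem le_vTop (v : Vtx) : v ≤ vTop := by
  have h : vTop = (⊤ : Vtx) := rfl
  rw [h]; exact le_top

theorem arc_ext {a b : Arc} (h1 : a.src = b.src) (h2 : a.tgt = b.tgt) : a = b := by
  cases a; cases b; simp_all

theorem cross_symm {a b : Arc} (h : Cross a b) : Cross b a := h.symm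

theorem cross_irrefl (a : Arc) : ¬ Cross a a := by
  rintro (⟨h, -⟩ | ⟨h, -⟩) <;> exact lt_irrefl _ h

/-- An arc crossing an arc below `β` and not crossing `β` lies below `β`. -/
theorem inside_of_cross {a b β : Arc} (h1 : β.src ≤ a.src) (h2 : a.tgt ≤ β.tgt)
    (hc : Cross b a) (hn : ¬ Cross b β) : β.src ≤ b.src ∧ b.tgt ≤ β.tgt := by
  unfold Cross at hc hn
  have := a.lt
  have := b.lt
  have := β.lt
  constructor
  · by_contra! h
    apply hn
    left
    rcases hc with ⟨p, q, r⟩ | ⟨p, q, r⟩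
    · exact ⟨h, h1.trans_lt q, r.trans_le h2⟩
    · exact absurd (h1.trans_lt p) (not_lt.mpr h.le)
  · by_contra! h
    apply hn
    right
    rcases hc with ⟨p, q, r⟩ | ⟨p, q, r⟩
    · exact absurd (r.trans_le h2) (not_lt.mpr h.le)
    · exact ⟨h1.trans_lt p, q.trans_le h2, h⟩

theorem flip_spec {T : Set Arc} {γ : Arc} (h : IsMutable T γ) :
    MutExchange T γ (flipArc T γ) := by
  unfold flipArc
  rw [dif_pos h.2]
  exact h.2.choose_spec

theorem flip_notMem {T : Set Arc} (hT : IsTriangulation T) {γ : Arc} (h : IsMutable T γ) :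
    flipArc T γ ∉ T := by
  intro hm
  obtain ⟨hne, ht⟩ := flip_spec h
  have hγ : γ ∈ (T \ {γ}) ∪ {flipArc T γ} := by
    apply ht.2
    rintro x (hx | hx)
    · exact hT.1 _ h.1 _ hx.1
    · rw [Set.mem_singleton_iff] at hx
      subst hx
      exact hT.1 _ h.1 _ hm
  rcases hγ with hγ | hγ
  · exact hγ.2 rfl
  · exact hne hγ.symm

theorem flip_cross {T : Set Arc} (hT : IsTriangulation T) {γ : Arc} (h : IsMutable T γ) :
    Cross γ (flipArc T γ) := by
  by_contra hc
  apply flip_notMem hT h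
  obtain ⟨hne, ht⟩ := flip_spec h
  apply hT.2
  intro x hx
  by_cases hxγ : x = γ
  · subst hxγ
    exact fun h => hc (cross_symm h)
  · exact ht.1 _ (Or.inr rfl) _ (Or.inl ⟨hx, hxγ⟩)

theorem mutate_eq_image {T : Set Arc} {γ : Arc} (h : γ ∈ T) :
    mutate T γ = mutArc T γ '' T := by
  ext x
  constructor
  · rintro (hx | hx)
    · exact ⟨x, hx.1, if_neg hx.2⟩
    · exact ⟨γ, h, by rw [Set.mem_singleton_iff] at hx; rw [hx]; exact if_pos rfl⟩
  · rintro ⟨y, hy, rfl⟩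
    unfold mutArc
    split_ifs with hyγ
    · exact Or.inr rfl
    · exact Or.inl ⟨hy, hyγ⟩

theorem mutArc_injOn {T : Set Arc} (hT : IsTriangulation T) {γ : Arc} (h : IsMutable T γ) :
    Set.InjOn (mutArc T γ) T := by
  intro x hx y hy hxy
  have hn := flip_notMem hT h
  unfold mutArc at hxy
  split_ifs at hxy with h1 h2 h2
  · rw [h1, h2]
  · exact absurd (hxy ▸ hy) hn
  · exact absurd (hxy ▸ hx) hn
  · exact hxy

section Iter

variable {T : Set Arc} {θ : ℕ → Option Arc}

theorem iterT_tri (hT : IsTriangulation T) (hθ : Admissible T θ) (k : ℕ) :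
    IsTriangulation (iterT T θ k) := by
  induction k with
  | zero => exact hT
  | succ k ih =>
    change IsTriangulation (stepT (iterT T θ k) (θ k))
    rcases hk : θ k with _ | γ
    · exact ih
    · exact (flip_spec (hθ.2.1 k γ hk)).2

theorem iterT_eq_image (hθ : Admissible T θ) (k : ℕ) :
    iterT T θ k = (fun δ => iterA T θ δ k) '' T := by
  induction k with
  | zero => simp [iterT, iterA]
  | succ k ih =>
    change stepT (iterT T θ k) (θ k) =
      (fun δ => stepA (iterT T θ k) (θ k) (iterA T θ δ k)) '' T
    have : (fun δ => stepA (iterT T θ k) (θ k) (iterA T θ δ k)) '' T =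
        stepA (iterT T θ k) (θ k) '' ((fun δ => iterA T θ δ k) '' T) := by
      rw [Set.image_image]
    rw [this, ← ih]
    rcases hk : θ k with _ | γ
    · change _ = (fun δ => δ) '' _
      simp [stepT]
    · exact mutate_eq_image (hθ.2.1 k γ hk).1

theorem iterA_mem (hθ : Admissible T θ) {δ : Arc} (hδ : δ ∈ T) (k : ℕ) :
    iterA T θ δ k ∈ iterT T θ k := by
  rw [iterT_eq_image hθ]
  exact ⟨δ, hδ, rfl⟩

theorem iterA_injOn (hT : IsTriangulation T) (hθ : Admissible T θ) (k : ℕ) :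
    Set.InjOn (fun δ => iterA T θ δ k) T := by
  induction k with
  | zero => intro x _ y _ h; exact h
  | succ k ih =>
    intro x hx y hy hxy
    apply ih hx hy
    change stepA (iterT T θ k) (θ k) (iterA T θ x k) =
      stepA (iterT T θ k) (θ k) (iterA T θ y k) at hxy
    rcases hk : θ k with _ | γ
    · rw [hk] at hxy; exact hxy
    · rw [hk] at hxy
      exact mutArc_injOn (iterT_tri hT hθ k) (hθ.2.1 k γ hk) (iterA_mem hθ hx k)
        (iterA_mem hθ hy k) hxy

theorem seqLimit_eventually (hθ : Admissible T θ) {δ : Arc} (hδ : δ ∈ T) :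
    ∀ᶠ k in Filter.atTop, iterA T θ δ k = seqLimit T θ δ := by
  have h := hθ.2.2 δ hδ
  unfold seqLimit
  rw [dif_pos h]
  exact Filter.eventually_atTop.mpr ⟨h.choose, fun k hk => h.choose_spec k hk⟩

theorem mutSeq_eventually (hθ : Admissible T θ) {x : Arc} (hx : x ∈ mutSeq T θ) :
    ∀ᶠ k in Filter.atTop, x ∈ iterT T θ k := by
  obtain ⟨δ, hδ, rfl⟩ := hx
  filter_upwards [seqLimit_eventually hθ hδ] with k hk
  rw [← hk]
  exact iterA_mem hθ hδ k

theorem mutSeq_compat (hT : IsTriangulation T) (hθ : Admissible T θ) :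
    ∀ x ∈ mutSeq T θ, ∀ y ∈ mutSeq T θ, ¬ Cross x y := by
  intro x hx y hy
  obtain ⟨k, h1, h2⟩ := ((mutSeq_eventually hθ hx).and (mutSeq_eventually hθ hy)).exists
  exact (iterT_tri hT hθ k).1 x h1 y h2

theorem generic_not_cross (x : Arc) : ¬ Cross generic x ∧ ¬ Cross x generic := by
  have h : ¬ Cross generic x := by
    rintro (⟨-, -, h⟩ | ⟨h, -, -⟩)
    · exact absurd h (not_lt.mpr (le_vTop _))
    · exact absurd h (not_lt.mpr (vBot_le _))
  exact ⟨h, fun h' => h (cross_symm h')⟩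

theorem generic_mem (hT : IsTriangulation T) (hθ : Admissible T θ) :
    generic ∈ mutSeq T θ := by
  have h0 : generic ∈ T := hT.2 _ fun x _ => (generic_not_cross x).1
  have h : ∀ k, iterA T θ generic k = generic := by
    intro k
    induction k with
    | zero => rfl
    | succ k ih =>
      change stepA (iterT T θ k) (θ k) (iterA T θ generic k) = _
      rw [ih]
      rcases hk : θ k with _ | γ
      · rfl
      · change mutArc _ γ generic = generic
        apply if_neg
        rintro rfl
        exact (generic_not_cross _).1 (flip_cross (iterT_tri hT hθ k) (hθ.2.1 k _ hk))
  obtain ⟨k, hk⟩ := (seqLimit_eventually hθ h0).exists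
  exact ⟨generic, h0, by rw [← hk, h]⟩

theorem inside_finite (x y : ℤ) :
    {a : Arc | vInt x ≤ a.src ∧ a.tgt ≤ vInt y}.Finite := by
  have hf : ((vInt '' Set.Icc x y) ×ˢ (vInt '' Set.Icc x y)).Finite :=
    ((Set.finite_Icc x y).image _).prod ((Set.finite_Icc x y).image _)
  have key : ∀ v : Vtx, vInt x ≤ v → v ≤ vInt y → v ∈ vInt '' Set.Icc x y := by
    intro v h1 h2
    rcases vtx_cases v with rfl | rfl | ⟨m, rfl⟩
    · exact absurd (vBot_lt_vInt x) (not_lt.mpr h1)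
    · exact absurd (vInt_lt_vTop y) (not_lt.mpr h2)
    · exact ⟨m, ⟨(vInt_le_iff _ _).1 h1, (vInt_le_iff _ _).1 h2⟩, rfl⟩
  refine Set.Finite.of_finite_image (f := fun a : Arc => (a.src, a.tgt)) (hf.subset ?_) ?_
  · rintro _ ⟨a, ⟨h1, h2⟩, rfl⟩
    exact ⟨key _ h1 (a.lt.le.trans h2), key _ (h1.trans a.lt.le) h2⟩
  · intro a _ b _ hab
    simp only [Prod.mk.injEq] at hab
    exact arc_ext hab.1 hab.2

/-- Below a peripheral arc of the limit, the limit is maximal. -/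
theorem mem_of_below (hT : IsTriangulation T) (hθ : Admissible T θ) {β γ : Arc}
    (hβ : β ∈ mutSeq T θ) {x y : ℤ} (hx : β.src = vInt x) (hy : β.tgt = vInt y)
    (h1 : β.src ≤ γ.src) (h2 : γ.tgt ≤ β.tgt) (hγ : ∀ ξ ∈ mutSeq T θ, ¬ Cross γ ξ) :
    γ ∈ mutSeq T θ := by
  obtain ⟨K, hK⟩ := Filter.eventually_atTop.mp (mutSeq_eventually hθ hβ)
  let I : Set Arc := {a : Arc | β.src ≤ a.src ∧ a.tgt ≤ β.tgt}
  have hI : I.Finite := by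
    have := inside_finite x y
    rwa [← hx, ← hy] at this
  let L : Set Arc := {δ ∈ T | iterA T θ δ K ∈ I}
  have hL : L.Finite := by
    refine Set.Finite.of_finite_image (f := fun δ => iterA T θ δ K) (hI.subset ?_) ?_
    · rintro _ ⟨δ, hδ, rfl⟩
      exact hδ.2
    · exact (iterA_injOn hT hθ K).mono fun δ hδ => hδ.1
  have hback : ∀ k, K ≤ k → ∀ δ ∈ T, iterA T θ δ k ∈ I → δ ∈ L := by
    intro k hk
    induction k, hk using Nat.le_induction with
    | base => exact fun δ hδ h => ⟨hδ, h⟩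
    | succ k hk ih =>
      intro δ hδ h
      apply ih δ hδ
      change stepA (iterT T θ k) (θ k) (iterA T θ δ k) ∈ I at h
      rcases hθk : θ k with _ | η
      · rw [hθk] at h; exact h
      · rw [hθk] at h
        change mutArc _ η _ ∈ I at h
        unfold mutArc at h
        split_ifs at h with he
        · have hm := hθ.2.1 k η hθk
          have htri := iterT_tri hT hθ k
          rw [he]
          exact inside_of_cross h.1 h.2 (flip_cross htri hm)
            (htri.1 _ hm.1 _ (hK k hk))
        · exact h
  have hev : ∀ᶠ k in Filter.atTop, ∀ δ ∈ L, iterA T θ δ k = seqLimit T θ δ :=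
    (Filter.eventually_all_finite hL).2 fun δ hδ => seqLimit_eventually hθ hδ.1
  obtain ⟨k, hk, hkK⟩ := (hev.and (Filter.eventually_ge_atTop K)).exists
  have hin : ∀ ζ ∈ iterT T θ k, ζ ∈ I → ζ ∈ mutSeq T θ := by
    intro ζ hζ hζI
    rw [iterT_eq_image hθ] at hζ
    obtain ⟨δ, hδ, rfl⟩ := hζ
    exact ⟨δ, hδ, (hk δ (hback k hkK δ hδ hζI)).symm⟩
  have htri := iterT_tri hT hθ k
  refine hin γ (htri.2 γ fun ζ hζ hc => ?_) ⟨h1, h2⟩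
  exact hγ ζ (hin ζ hζ (inside_of_cross h1 h2 (cross_symm hc) (htri.1 _ hζ _ (hK k hkK)))) hc

theorem peripheral_mem (hT : IsTriangulation T) (hθ : Admissible T θ) {γ : Arc} {m n : ℤ}
    (hm : γ.src = vInt m) (hn : γ.tgt = vInt n)
    (hγ : ∀ ξ ∈ completedMut T θ, ¬ Cross γ ξ) : γ ∈ mutSeq T θ := by
  by_contra hnot
  have hS : ∀ ξ ∈ mutSeq T θ, ¬ Cross γ ξ := fun ξ h => hγ ξ (Or.inl (Or.inl h))
  have habove : ∀ ξ ∈ mutSeq T θ, ξ.src ≤ vInt m → vInt n ≤ ξ.tgt →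
      ξ.src = vBot ∨ ξ.tgt = vTop := by
    intro ξ hξ h1 h2
    by_contra! hcon
    have hlt := ξ.lt
    rcases vtx_cases ξ.src with h | h | ⟨x, hx⟩
    · exact hcon.1 h
    · exact absurd (h ▸ hlt) (not_lt.mpr (le_vTop _))
    rcases vtx_cases ξ.tgt with h | h | ⟨y, hy⟩
    · exact absurd (h ▸ hlt) (not_lt.mpr (vBot_le _))
    · exact hcon.2 h
    exact hnot (mem_of_below hT hθ hξ hx hy (hm ▸ h1) (hn ▸ h2) hS)
  have hsep := γ.sep m n hm hn
  obtain ⟨w, ⟨hmw, hwn, hw⟩, hmax⟩ := Int.exists_greatest_of_bdd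
    (P := fun w => m < w ∧ w < n ∧ (w = m + 1 ∨ HasArc (mutSeq T θ) (vInt m) (vInt w)))
    ⟨n, fun z hz => hz.2.1.le⟩ ⟨m + 1, by omega, by omega, Or.inl rfl⟩
  have hmw' := (vInt_lt_iff _ _).2 hmw
  have hwn' := (vInt_lt_iff _ _).2 hwn
  have hkey : ∀ ξ ∈ mutSeq T θ, ξ.src < vInt w → vInt w < ξ.tgt →
      ξ.src ≤ vInt m ∧ vInt n ≤ ξ.tgt := by
    intro ξ hξ h1 h2
    have hsrc : ξ.src ≤ vInt m := by
      rcases hw with rfl | ⟨β, hβ, hb1, hb2⟩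
      · rcases vtx_cases ξ.src with h | h | ⟨x, hx⟩
        · rw [h]; exact vBot_le _
        · rw [h] at h1; exact absurd h1 (not_lt.mpr (le_vTop _))
        · rw [hx, vInt_lt_iff] at h1
          rw [hx, vInt_le_iff]; omega
      · by_contra! h
        exact mutSeq_compat hT hθ β hβ ξ hξ (Or.inl ⟨hb1 ▸ h, hb2 ▸ h1, hb2 ▸ h2⟩)
    refine ⟨hsrc, ?_⟩
    by_contra! h
    rcases hsrc.lt_or_eq with hl | he
    · exact hS ξ hξ (Or.inr ⟨hm ▸ hl, hm ▸ hmw'.trans h2, hn ▸ h⟩)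
    · rcases vtx_cases ξ.tgt with h' | h' | ⟨y, hy⟩
      · rw [h'] at h2; exact absurd h2 (not_lt.mpr (vBot_le _))
      · rw [h'] at h; exact absurd h (not_lt.mpr (le_vTop _))
      · rw [hy, vInt_lt_iff] at h h2
        have := hmax y ⟨hmw.trans h2, h, Or.inr ⟨ξ, hξ, he, hy⟩⟩
        omega
  -- the Prüfer curve at `w` crosses `γ`, hence is crossed by an arc of the limit
  have hP : prufer w ∉ pruferCompletion (mutSeq T θ) := fun h =>
    hγ _ (Or.inl (Or.inr h)) (Or.inl ⟨hm ▸ hmw', hn ▸ hwn', hn ▸ vInt_lt_vTop n⟩)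
  have hA : adic w ∉ adicCompletion' (mutSeq T θ) := fun h =>
    hγ _ (Or.inr h) (Or.inr ⟨hm ▸ vBot_lt_vInt m, hm ▸ hmw', hn ▸ hwn'⟩)
  have hP' : ∃ ξ ∈ mutSeq T θ, Cross (prufer w) ξ := by
    by_contra! h
    exact hP ⟨⟨w, rfl⟩, h⟩
  have hA' : ∃ ξ ∈ mutSeq T θ ∪ pruferCompletion (mutSeq T θ), Cross (adic w) ξ := by
    by_contra! h
    exact hA ⟨⟨w, rfl⟩, h⟩
  obtain ⟨ξ, hξ, hc⟩ := hP'
  rcases hc with ⟨-, -, h⟩ | ⟨a1, a2, a3⟩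
  · exact absurd h (not_lt.mpr (le_vTop _))
  change ξ.src < vInt w at a1
  change vInt w < ξ.tgt at a2
  change ξ.tgt < vTop at a3
  obtain ⟨b1, b2⟩ := hkey ξ hξ a1 a2
  have hbot : ξ.src = vBot := (habove ξ hξ b1 b2).resolve_right a3.ne
  obtain ⟨ζ, hζ, hc⟩ := hA'
  rcases hc with ⟨c1, c2, c3⟩ | ⟨h, -, -⟩
  swap
  · exact absurd h (not_lt.mpr (vBot_le _))
  change vBot < ζ.src at c1
  change ζ.src < vInt w at c2
  change vInt w < ζ.tgt at c3
  have htop : ζ.tgt = vTop := by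
    rcases hζ with hζ | ⟨⟨k, rfl⟩, -⟩
    · obtain ⟨d1, d2⟩ := hkey ζ hζ c2 c3
      exact (habove ζ hζ d1 d2).resolve_left c1.ne'
    · rfl
  have hcr : Cross ζ ξ := Or.inr ⟨hbot ▸ c1, c2.trans a2, htop ▸ a3⟩
  rcases hζ with hζ | hζ
  · exact mutSeq_compat hT hθ ζ hζ ξ hξ hcr
  · exact hζ.2 ξ hξ hcr

end Iter

/-- The completed mutation of a triangulation of the completed ∞-gon along an admissible
sequence is a triangulation of the completed ∞-gon. -/
theorem statement17 (T : Set Arc) (hT : IsTriangulation T) (θ : ℕ → Option Arc)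
    (hθ : Admissible T θ) :
    IsTriangulation (completedMut T θ) := by
  constructor
  · have hSS := mutSeq_compat hT hθ
    have hPP : ∀ x ∈ pruferCompletion (mutSeq T θ), ∀ y ∈ pruferCompletion (mutSeq T θ),
        ¬ Cross x y := by
      rintro _ ⟨⟨a, rfl⟩, -⟩ _ ⟨⟨b, rfl⟩, -⟩ (⟨-, -, h⟩ | ⟨-, -, h⟩) <;> exact lt_irrefl _ h
    have hAA : ∀ x ∈ adicCompletion' (mutSeq T θ), ∀ y ∈ adicCompletion' (mutSeq T θ),
        ¬ Cross x y := by
      rintro _ ⟨⟨a, rfl⟩, -⟩ _ ⟨⟨b, rfl⟩, -⟩ (⟨h, -, -⟩ | ⟨h, -, -⟩) <;> exact lt_irrefl _ h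
    rintro x ((hx | hx) | hx) y ((hy | hy) | hy) hc
    · exact hSS x hx y hy hc
    · exact hy.2 x hx (cross_symm hc)
    · exact hy.2 x (Or.inl hx) (cross_symm hc)
    · exact hx.2 y hy hc
    · exact hPP x hx y hy hc
    · exact hy.2 x (Or.inr hx) (cross_symm hc)
    · exact hx.2 y (Or.inl hy) hc
    · exact hx.2 y (Or.inr hy) hc
    · exact hAA x hx y hy hc
  · intro γ hγ
    have hlt := γ.lt
    rcases vtx_cases γ.src with hs | hs | ⟨m, hs⟩
    · rcases vtx_cases γ.tgt with ht | ht | ⟨n, ht⟩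
      · rw [hs, ht] at hlt; exact absurd hlt (lt_irrefl _)
      · have : γ = generic := arc_ext hs ht
        rw [this]
        exact Or.inl (Or.inl (generic_mem hT hθ))
      · exact Or.inr ⟨⟨n, arc_ext hs ht⟩, fun x hx => hγ x (Or.inl hx)⟩
    · rw [hs] at hlt; exact absurd hlt (not_lt.mpr (le_vTop _))
    · rcases vtx_cases γ.tgt with ht | ht | ⟨n, ht⟩
      · rw [ht] at hlt; exact absurd hlt (not_lt.mpr (vBot_le _))
      · exact Or.inl (Or.inr ⟨⟨m, arc_ext hs ht⟩, fun x hx => hγ x (Or.inl (Or.inl hx))⟩)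
      · exact Or.inl (Or.inl (peripheral_mem hT hθ hs ht hγ))
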